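/- In a free Lie algebra over ℂ, any two commuting elements are linearly dependent. -/

import Mathlib

namespace FLA
open Polynomial TensorProduct

attribute [local instance] LieRing.ofAssociativeRing

variable {X : Type}

noncomputable section

abbrev A (X : Type) := FreeAlgebra ℂ X
abbrev L (X : Type) := FreeLieAlgebra ℂ X

/-- augmentation -/
def aug : A X →ₐ[ℂ] ℂ := FreeAlgebra.lift ℂ (fun _ => 0)

@[simp] lemma aug_ι (x : X) : aug (FreeAlgebra.ι ℂ x) = 0 := by simp [aug]

/-- the homogenizing homomorphism -/
def Th : A X →ₐ[ℂ] (A X)[X] := FreeAlgebra.lift ℂ (fun x => monomial 1 (FreeAlgebra.ι ℂ x))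

@[simp] lemma Th_ι (x : X) : Th (FreeAlgebra.ι ℂ x) = monomial 1 (FreeAlgebra.ι ℂ x) := by
  simp [Th]

/-- coproduct -/
def Dl : A X →ₐ[ℂ] (A X ⊗[ℂ] A X) :=
  FreeAlgebra.lift ℂ (fun x => FreeAlgebra.ι ℂ x ⊗ₜ 1 + 1 ⊗ₜ FreeAlgebra.ι ℂ x)

@[simp] lemma Dl_ι (x : X) : Dl (FreeAlgebra.ι ℂ x) =
    FreeAlgebra.ι ℂ x ⊗ₜ[ℂ] 1 + 1 ⊗ₜ[ℂ] FreeAlgebra.ι ℂ x := by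
  simp [Dl]

lemma Th_algebraMap (r : ℂ) : Th (algebraMap ℂ (A X) r) = C (algebraMap ℂ (A X) r) := by
  rw [AlgHom.commutes]; rfl

lemma coeff_zero_Th (u : A X) : (Th u).coeff 0 = algebraMap ℂ (A X) (aug u) := by
  induction u using FreeAlgebra.induction with
  | grade0 r => simp [-AlgHom.commutes, Th_algebraMap]
  | grade1 x => simp [coeff_monomial]
  | mul a b ha hb => simp [mul_coeff_zero, ha, hb]
  | add a b ha hb => simp [ha, hb]

lemma Th_coeff (u : A X) (n : ℕ) : Th ((Th u).coeff n) = monomial n ((Th u).coeff n) := by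
  induction u using FreeAlgebra.induction generalizing n with
  | grade0 r =>
    rw [Th_algebraMap, coeff_C]
    split_ifs with h
    · subst h; rw [Th_algebraMap]; rfl
    · simp
  | grade1 x =>
    rw [Th_ι, coeff_monomial]
    split_ifs with h
    · subst h; simp
    · simp
  | mul a b ha hb =>
    rw [map_mul, coeff_mul, map_sum, map_sum]
    refine Finset.sum_congr rfl fun ij hij => ?_
    rw [map_mul, ha, hb, monomial_mul_monomial, Finset.HasAntidiagonal.mem_antidiagonal.1 hij]
  | add a b ha hb => simp [ha, hb]

/-- existence of cocycles -/
lemma exists_cocycle {M : Type} [AddCommGroup M] [Module ℂ M]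
    (ρ : A X →ₐ[ℂ] Module.End ℂ M) (f : X → M) :
    ∃ D : A X →ₗ[ℂ] M, (∀ u v, D (u * v) = ρ u (D v) + aug v • D u) ∧
      ∀ x, D (FreeAlgebra.ι ℂ x) = f x := by
  let g : X → Module.End ℂ (M × ℂ) := fun x =>
    LinearMap.prod ((ρ (FreeAlgebra.ι ℂ x)).comp (LinearMap.fst ℂ M ℂ) +
      (LinearMap.toSpanSingleton ℂ M (f x)).comp (LinearMap.snd ℂ M ℂ)) 0
  let Φ : A X →ₐ[ℂ] Module.End ℂ (M × ℂ) := FreeAlgebra.lift ℂ g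
  have h1 : ∀ u, ∀ m : M, Φ u (m, 0) = (ρ u m, 0) := by
    intro u
    induction u using FreeAlgebra.induction with
    | grade0 r => intro m; simp [Module.algebraMap_end_apply]
    | grade1 x => intro m; simp [Φ, g]
    | mul a b ha hb => intro m; simp [ha, hb]
    | add a b ha hb => intro m; simp [ha, hb]
  have h2 : ∀ u, ∀ m : M × ℂ, (Φ u m).2 = aug u * m.2 := by
    intro u
    induction u using FreeAlgebra.induction with
    | grade0 r => intro m; simp [Module.algebraMap_end_apply]
    | grade1 x => intro m; simp [Φ, g]
    | mul a b ha hb => intro m; simp [ha, hb, mul_assoc]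
    | add a b ha hb => intro m; simp [ha, hb, add_mul]
  refine ⟨(LinearMap.fst ℂ M ℂ).comp ((LinearMap.applyₗ ((0, 1) : M × ℂ)).comp Φ.toLinearMap),
    ?_, ?_⟩
  · intro u v
    have : Φ v (0, 1) = ((Φ v (0, 1)).1, 0) + aug v • ((0, 1) : M × ℂ) := by
      ext
      · simp
      · simp [h2]
    simp only [LinearMap.comp_apply, LinearMap.applyₗ_apply_apply, AlgHom.toLinearMap_apply, map_mul,
      LinearMap.fst_apply, Module.End.mul_apply]
    rw [this, map_add, map_smul, h1]
    simp
  · intro x; simp [Φ, g]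

/-- the right Fox derivative exists -/
lemma exists_fox : ∃ R : A X →ₗ[ℂ] (X →₀ A X),
    (∀ u v, R (u * v) = u • R v + aug v • R u) ∧
    (∀ x, R (FreeAlgebra.ι ℂ x) = Finsupp.single x 1) ∧
    (∀ u, u = algebraMap ℂ _ (aug u) + (R u).sum fun x c => c * FreeAlgebra.ι ℂ x) := by
  obtain ⟨R, h1, h2⟩ := exists_cocycle (M := X →₀ A X) (Algebra.lsmul ℂ ℂ (X →₀ A X))
    (fun x => Finsupp.single x 1)
  refine ⟨R, by simpa using h1, h2, ?_⟩
  let S : (X →₀ A X) →ₗ[A X] A X := Finsupp.linearCombination (A X) (FreeAlgebra.ι ℂ)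
  have hS : ∀ f, (f.sum fun x c => c * FreeAlgebra.ι ℂ x) = S f := by
    intro f; simp [S, Finsupp.linearCombination_apply]
  have hR1 : R 1 = 0 := by
    have := h1 1 1
    simpa using this
  intro u
  rw [hS]
  induction u using FreeAlgebra.induction with
  | grade0 r => 
    rw [Algebra.algebraMap_eq_smul_one, map_smul R, hR1]; simp [Algebra.algebraMap_eq_smul_one]
  | grade1 x => simp [h2, S]
  | mul a b ha hb =>
    rw [h1]
    have e : S (aug b • R a) = aug b • S (R a) := by
      rw [← algebraMap_smul (A X) (aug b) (R a), map_smul, algebraMap_smul]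
    rw [map_add, e]
    simp only [Algebra.lsmul_coe, map_smul, smul_eq_mul, map_mul]
    conv_lhs => rw [hb, mul_add]
    rw [← Algebra.commutes (aug b) a, ← Algebra.smul_def]
    conv_lhs => 
      enter [1, 2]
      rw [ha]
    rw [smul_add, Algebra.smul_def (aug b) (algebraMap _ _ _), ← map_mul, mul_comm (aug b), map_mul]
    abel
  | add a b ha hb =>
    conv_lhs => rw [ha, hb]
    simp only [map_add]
    abel

def Hom (n : ℕ) (a : A X) : Prop := Th a = monomial n a

lemma division_aux (a b : A X) (n : ℕ) : ∀ m a' b', Hom n a' → Hom m b' → n ≤ m → a' ≠ 0 →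
    a * b' = b * a' → ∃ z, b = a * z := by
  obtain ⟨R, h1, h2, h3⟩ := exists_fox (X := X)
  have hR1 : R 1 = 0 := by
    have := h1 1 1
    simpa using this
  have hco : ∀ u n x, (Th (R u x)).coeff n = R ((Th u).coeff (n+1)) x := by
    intro u n x
    have e : (Th u).coeff (n+1) = (R u).sum fun y c => (Th c).coeff n * FreeAlgebra.ι ℂ y := by
      conv_lhs => rw [h3 u]
      rw [map_add, Th_algebraMap, coeff_add, coeff_C_succ, zero_add, Finsupp.sum, map_sum,
        finsetSum_coeff]
      refine Finset.sum_congr rfl fun y _ => ?_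
      rw [map_mul, Th_ι, coeff_mul_monomial]
    rw [e, Finsupp.sum, map_sum, Finsupp.finsetSum_apply]
    simp only [h1, h2, aug_ι, zero_smul, add_zero]
    rw [Finset.sum_eq_single x]
    · simp
    · intro y _ hy
      simp [Finsupp.single_eq_of_ne hy.symm]
    · intro hx
      simp [Finsupp.notMem_support_iff.1 hx]
  have hRh : ∀ n u x, Hom (n+1) u → Hom n (R u x) := by
    intro n u x hu
    unfold Hom at *
    ext1 k
    rw [hco, hu, coeff_monomial, coeff_monomial]
    by_cases hk : n = k <;> simp [hk]
  have haug : ∀ n (u : A X), Hom (n+1) u → aug u = 0 := by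
    intro n u hu
    have := coeff_zero_Th u
    rw [hu, coeff_monomial, if_neg (by omega)] at this
    exact ((map_eq_zero_iff _ (FreeAlgebra.algebraMap_leftInverse (R := ℂ) (X := X)).injective).1 this.symm)
  induction n with
  | zero =>
    intro m a' b' ha' hb' hnm h0 h
    have e := coeff_zero_Th a'
    rw [ha', coeff_monomial, if_pos rfl] at e
    have hc : aug a' ≠ 0 := by
      intro hc; apply h0; rw [e, hc, map_zero]
    refine ⟨(aug a')⁻¹ • b', ?_⟩
    rw [mul_smul_comm, h, e]
    rw [← Algebra.commutes, ← Algebra.smul_def, AlgHom.commutes]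
    simp [smul_smul, hc]
  | succ n ih =>
    intro m a' b' ha' hb' hnm h0 h
    obtain ⟨m, rfl⟩ : ∃ k, m = k + 1 := ⟨m - 1, by omega⟩
    have hx : ∃ x, R a' x ≠ 0 := by
      by_contra! hx
      apply h0
      have : R a' = 0 := by ext1 x; simpa using hx x
      rw [h3 a', this, haug _ _ ha']; simp
    obtain ⟨x, hx⟩ := hx
    refine ih m (R a' x) (R b' x) (hRh _ _ _ ha') (hRh _ _ _ hb') (by omega) hx ?_
    have := congrArg (fun u => R u x) h
    simpa [h1, haug _ _ ha', haug _ _ hb'] using this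

lemma division {a b : A X} {p q : ℕ} (ha : Hom p a) (hb : Hom q b) (hpq : p ≤ q) (h0 : a ≠ 0)
    (h : a * b = b * a) : ∃ z, b = a * z :=
  division_aux a b p q a b ha hb hpq h0 h

def Prim (a : A X) : Prop := Dl a = a ⊗ₜ[ℂ] 1 + 1 ⊗ₜ[ℂ] a

def contr (φ : A X →ₗ[ℂ] ℂ) : A X ⊗[ℂ] A X →ₗ[ℂ] A X :=
  (TensorProduct.lid ℂ (A X)).toLinearMap.comp (LinearMap.rTensor (A X) φ)

@[simp] lemma contr_tmul (φ : A X →ₗ[ℂ] ℂ) (u v : A X) : contr φ (u ⊗ₜ v) = φ u • v := by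
  simp [contr]

lemma contr_aug (u : A X) : contr aug.toLinearMap (Dl u) = u := by
  have : ((Algebra.TensorProduct.lid ℂ (A X)).toAlgHom.comp
    (Algebra.TensorProduct.map aug (AlgHom.id ℂ (A X)))).comp Dl = AlgHom.id ℂ (A X) := by
    ext x; simp
  have h2 : ∀ t, contr aug.toLinearMap t = ((Algebra.TensorProduct.lid ℂ (A X)).toAlgHom.comp
    (Algebra.TensorProduct.map aug (AlgHom.id ℂ (A X)))) t := by
    intro t
    induction t with
    | zero => simp
    | tmul u v => simp
    | add s t hs ht => rw [map_add, map_add, hs, ht]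
  rw [h2]
  exact DFunLike.congr_fun this u

lemma prim_irred {a b z : A X} {p q : ℕ} (hp : 0 < p) (hpq : p < q) (ha : Hom p a) (hb : Hom q b)
    (pa : Prim a) (pb : Prim b) (h0 : a ≠ 0) (h : b = a * z) : b = 0 := by
  obtain ⟨ψ, hψ⟩ : ∃ ψ : A X →ₗ[ℂ] ℂ, ψ a = 1 := by
    obtain ⟨f, hf⟩ := Module.Projective.exists_dual_ne_zero ℂ h0
    exact ⟨(f a)⁻¹ • f, by simp [hf]⟩
  let φ : A X →ₗ[ℂ] ℂ := ψ.comp (((lcoeff (A X) p).restrictScalars ℂ).comp Th.toLinearMap)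
  have hφ : ∀ u, φ u = ψ ((Th u).coeff p) := fun u => rfl
  have hφa : φ.comp (LinearMap.mulLeft ℂ a) = aug.toLinearMap := by
    ext1 u
    rw [LinearMap.comp_apply, hφ, LinearMap.mulLeft_apply, map_mul, ha]
    have := coeff_monomial_mul (Th u) p 0 a
    rw [zero_add] at this
    rw [this, coeff_zero_Th, ← Algebra.commutes, ← Algebra.smul_def, map_smul, hψ]
    simp
  have key : ∀ t, contr φ ((a ⊗ₜ[ℂ] 1 + 1 ⊗ₜ[ℂ] a) * t) =
      contr (φ.comp (LinearMap.mulLeft ℂ a)) t + a * contr φ t := by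
    intro t
    induction t with
    | zero => simp
    | tmul u v => simp [add_mul]
    | add s t hs ht => simp only [mul_add, map_add, hs, ht]; abel
  let d : A X → A X := fun u => contr φ (Dl u)
  have d_smul : ∀ (c : ℂ) u, d (c • u) = c • d u := by intro c u; simp [d]
  have d_neg : ∀ u, d (-u) = - d u := by intro u; simp [d]
  have d_mul : ∀ u, d (a * u) = u + a * d u := by
    intro u
    change contr φ (Dl (a * u)) = _
    rw [map_mul, pa, key, hφa, contr_aug]
  have db : d b = 0 := by
    change contr φ (Dl b) = _
    rw [pb, map_add, contr_tmul, contr_tmul, hφ, hφ, hb, coeff_monomial, if_neg (by omega), map_one,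
      coeff_one, if_neg (by omega)]
    simp
  have hk : ∀ k : ℕ, ((k : ℂ) + 1) • d^[k] z = - (a * d^[k+1] z) := by
    intro k
    induction k with
    | zero =>
      have := d_mul z
      rw [← h, db] at this
      simpa using eq_neg_of_add_eq_zero_left this.symm
    | succ k ih =>
      have := congrArg d ih
      rw [d_smul, d_neg, d_mul, ← Function.iterate_succ_apply' d, ← Function.iterate_succ_apply' d]
        at this
      push_cast
      rw [add_smul, this]
      simp
  have hk2 : ∀ k : ℕ, ∃ w, b = a ^ k * w := by
    have : ∀ k : ℕ, ∃ s : ℂ, z = s • (a ^ k * d^[k] z) := by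
      intro k
      induction k with
      | zero => exact ⟨1, by simp⟩
      | succ k ih =>
        obtain ⟨s, hs⟩ := ih
        have h3 : d^[k] z = -(((k : ℂ) + 1)⁻¹ • (a * d^[k+1] z)) := by
          rw [← smul_neg, ← hk, smul_smul, inv_mul_cancel₀ (Nat.cast_add_one_ne_zero k), one_smul]
        refine ⟨-(s * ((k : ℂ) + 1)⁻¹), ?_⟩
        conv_lhs => rw [hs, h3]
        simp [pow_succ, mul_assoc, smul_smul]
    intro k
    obtain ⟨s, hs⟩ := this k
    refine ⟨a * (s • d^[k] z), ?_⟩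
    rw [← mul_assoc, ← pow_succ, pow_succ', mul_assoc, mul_smul_comm, ← hs, h]
  obtain ⟨w, hw⟩ := hk2 (q+1)
  have h5 : (Th b).coeff q = b := by rw [hb]; simp
  rw [← h5]
  conv_lhs => rw [hw]
  rw [map_mul, map_pow, ha, monomial_pow, ← C_mul_X_pow_eq_monomial, mul_assoc, coeff_C_mul,
    X_pow_mul, coeff_mul_X_pow', if_neg, mul_zero]
  nlinarith

def incl : L X →ₗ⁅ℂ⁆ A X := FreeLieAlgebra.lift ℂ (FreeAlgebra.ι ℂ)

@[simp] lemma incl_of (x : X) : incl (FreeLieAlgebra.of ℂ x) = FreeAlgebra.ι ℂ x := by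
  simp [incl]

lemma incl_lie (x y : L X) : incl ⁅x, y⁆ = incl x * incl y - incl y * incl x := by
  rw [LieHom.map_lie, LieRing.of_associative_ring_bracket]

lemma lie_ind (P : Submodule ℂ (L X)) (hof : ∀ x, FreeLieAlgebra.of ℂ x ∈ P)
    (hl : ∀ x y, x ∈ P → y ∈ P → ⁅x, y⁆ ∈ P) (x : L X) : x ∈ P := by
  let S : LieSubalgebra ℂ (L X) := { P with lie_mem' := fun {x y} hx hy => hl x y hx hy }
  let f : L X →ₗ⁅ℂ⁆ S := FreeLieAlgebra.lift ℂ (fun x => ⟨FreeLieAlgebra.of ℂ x, hof x⟩)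
  have : S.incl.comp f = LieHom.id := by
    ext x
    simp [f]
  have h2 := congrArg (fun g : L X →ₗ⁅ℂ⁆ L X => g x) this
  simp only [LieHom.comp_apply, LieHom.id_apply] at h2
  rw [← h2]
  exact (f x).2

lemma prim_incl (x : L X) : Prim (incl x) := by
  let P : Submodule ℂ (L X) :=
    { carrier := {x | Prim (incl x)}
      add_mem' := by
        intro a b ha hb
        simp only [Set.mem_ofPred_eq, Prim, map_add] at *
        rw [ha, hb, TensorProduct.add_tmul, TensorProduct.tmul_add]; abel
      zero_mem' := by simp [Prim]
      smul_mem' := by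
        intro c a ha
        simp only [Set.mem_ofPred_eq, Prim, map_smul] at *
        rw [ha, smul_add, TensorProduct.smul_tmul', TensorProduct.tmul_smul] }
  refine lie_ind P ?_ ?_ x
  · intro x; change Prim _; simp [Prim]
  · intro x y hx hy
    change Prim _
    change Prim _ at hx
    change Prim _ at hy
    unfold Prim at *
    rw [incl_lie, map_sub, map_mul, map_mul, hx, hy]
    simp only [add_mul, mul_add, Algebra.TensorProduct.tmul_mul_tmul, one_mul, mul_one,
      TensorProduct.sub_tmul, TensorProduct.tmul_sub]
    abel

/-- Dynkin -/
lemma exists_dynkin : ∃ D : A X →ₗ[ℂ] L X,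
    (∀ x, D (FreeAlgebra.ι ℂ x) = FreeLieAlgebra.of ℂ x) ∧
    (∀ x y, D (incl ⁅x, y⁆) = ⁅x, D (incl y)⁆ - ⁅y, D (incl x)⁆) := by
  let ρ : A X →ₐ[ℂ] Module.End ℂ (L X) :=
    FreeAlgebra.lift ℂ (fun x => (LieModule.toEnd ℂ (L X) (L X) (FreeLieAlgebra.of ℂ x)))
  obtain ⟨D, h1, h2⟩ := exists_cocycle ρ (fun x => FreeLieAlgebra.of ℂ x)
  refine ⟨D, h2, ?_⟩
  have hρ : ∀ x : L X, ρ (incl x) = LieModule.toEnd ℂ (L X) (L X) x := by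
    intro x
    refine lie_ind (LinearMap.eqLocus (ρ.toLinearMap.comp (incl (X := X)).toLinearMap)
      (LieModule.toEnd ℂ (L X) (L X) : L X →ₗ[ℂ] Module.End ℂ (L X))) ?_ ?_ x
    · intro x; simp [ρ]
    · intro x y hx hy
      simp only [LinearMap.mem_eqLocus, LinearMap.comp_apply, LieHom.coe_toLinearMap,
        AlgHom.toLinearMap_apply] at *
      rw [incl_lie, map_sub, map_mul, map_mul, hx, hy, LieHom.map_lie]
      rfl
  have haug : ∀ x : L X, aug (incl x) = 0 := by
    intro x
    refine lie_ind (LinearMap.ker (aug.toLinearMap.comp (incl (X := X)).toLinearMap)) ?_ ?_ x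
    · intro x; simp
    · intro x y hx hy
      simp only [LinearMap.mem_ker, LinearMap.comp_apply, LieHom.coe_toLinearMap,
        AlgHom.toLinearMap_apply] at *
      rw [incl_lie, map_sub, map_mul, map_mul, hx, hy]; simp
  intro x y
  rw [incl_lie, map_sub, h1, h1, hρ, hρ, haug, haug]
  simp

lemma exists_good : ∃ J : (A X)[X] →ₗ[ℂ] L X, ∀ x : L X, J (Th (incl x)) = x ∧
    (Th (incl x)).coeff 0 = 0 ∧ ∀ n, ∃ x', (Th (incl x)).coeff n = incl x' := by
  obtain ⟨D, h1, h2⟩ := exists_dynkin (X := X)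
  let S : Set (L X) := {x | ∃ n : ℕ, 0 < n ∧ Hom n (incl x) ∧ D (incl x) = (n : ℂ) • x}
  have hS : ∀ x, x ∈ Submodule.span ℂ S := by
    intro x
    refine lie_ind _ ?_ ?_ x
    · intro x
      refine Submodule.subset_span ⟨1, one_pos, ?_, ?_⟩
      · simp [Hom]
      · simp [h1]
    · intro x y hx hy
      induction hx, hy using Submodule.span_induction₂ with
      | mem_mem x y hx hy =>
        obtain ⟨n, hn, hx1, hx2⟩ := hx
        obtain ⟨m, hm, hy1, hy2⟩ := hy
        refine Submodule.subset_span ⟨n + m, by omega, ?_, ?_⟩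
        · unfold Hom at *
          rw [incl_lie, map_sub, map_mul, map_mul, hx1, hy1, monomial_mul_monomial,
            monomial_mul_monomial, add_comm m n, map_sub]
        · rw [h2, hx2, hy2, lie_smul, lie_smul, ← lie_skew x y]
          push_cast
          module
      | zero_left y hy => simp
      | zero_right x hx => simp
      | add_left x y z _ _ _ hx hy => rw [add_lie]; exact add_mem hx hy
      | add_right x y z _ _ _ hx hy => rw [lie_add]; exact add_mem hx hy
      | smul_left r x y _ _ h => rw [smul_lie]; exact Submodule.smul_mem _ _ h
      | smul_right r x y _ _ h => rw [lie_smul]; exact Submodule.smul_mem _ _ h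
  let J : (A X)[X] →ₗ[ℂ] L X := Polynomial.lsum (fun n => (n : ℂ)⁻¹ • D)
  have hJ : ∀ n u, J (monomial n u) = (n : ℂ)⁻¹ • D u := by
    intro n u
    simp [J, Polynomial.lsum_apply]
  refine ⟨J, fun x => ?_⟩
  induction hS x using Submodule.span_induction with
  | mem x hx =>
    obtain ⟨n, hn, hx1, hx2⟩ := hx
    unfold Hom at hx1
    rw [hx1]
    refine ⟨?_, ?_, ?_⟩
    · rw [hJ, hx2, smul_smul, inv_mul_cancel₀ (by exact_mod_cast hn.ne'), one_smul]
    · rw [coeff_monomial, if_neg hn.ne']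
    · intro k
      rw [coeff_monomial]
      split_ifs
      · exact ⟨x, rfl⟩
      · exact ⟨0, by simp⟩
  | zero => simpa using ⟨0, by simp⟩
  | add x y _ _ hx hy =>
    obtain ⟨a1, a2, a3⟩ := hx
    obtain ⟨b1, b2, b3⟩ := hy
    simp only [map_add, coeff_add, a1, b1, a2, b2, true_and, add_zero]
    intro n
    obtain ⟨x', hx'⟩ := a3 n
    obtain ⟨y', hy'⟩ := b3 n
    exact ⟨x' + y', by rw [hx', hy', map_add]⟩
  | smul c x _ hx =>
    obtain ⟨a1, a2, a3⟩ := hx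
    simp only [map_smul, coeff_smul, a1, a2, true_and, smul_zero]
    intro n
    obtain ⟨x', hx'⟩ := a3 n
    exact ⟨c • x', by rw [hx', map_smul]⟩

lemma Th_incl_ne {x : L X} (hx : x ≠ 0) : Th (incl x) ≠ 0 := by
  obtain ⟨J, hJ⟩ := exists_good (X := X)
  intro h
  apply hx
  rw [← (hJ x).1, h, map_zero]

lemma hom_case {a b : A X} {p q : ℕ} (hp : 0 < p) (hpq : p ≤ q) (ha : Hom p a) (hb : Hom q b)
    (pa : Prim a) (pb : Prim b) (ha0 : a ≠ 0) (hb0 : b ≠ 0) (h : a * b = b * a) :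
    p = q ∧ ∃ c : ℂ, b = c • a := by
  obtain ⟨z, hz⟩ := division ha hb hpq ha0 h
  rcases hpq.lt_or_eq with hlt | rfl
  · exact absurd (prim_irred hp hlt ha hb pa pb ha0 hz) hb0
  · refine ⟨rfl, aug z, ?_⟩
    have h5 : (Th b).coeff p = b := by rw [hb]; simp
    rw [← h5]
    conv_lhs => rw [hz]
    have := coeff_monomial_mul (Th z) p 0 a
    rw [zero_add] at this
    rw [map_mul, ha, this, coeff_zero_Th, ← Algebra.commutes, ← Algebra.smul_def]

lemma key (x y : L X) (hx : x ≠ 0) (hy : y ≠ 0) (h : ⁅x, y⁆ = 0) :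
    (Th (incl x)).natDegree = (Th (incl y)).natDegree ∧
    ∃ c : ℂ, (Th (incl y)).leadingCoeff = c • (Th (incl x)).leadingCoeff := by
  obtain ⟨J, hJ⟩ := exists_good (X := X)
  have hP := Th_incl_ne hx
  have hQ := Th_incl_ne hy
  have hcomm : Th (incl x) * Th (incl y) = Th (incl y) * Th (incl x) := by
    have := incl_lie x y
    rw [h, map_zero] at this
    rw [← map_mul Th, ← map_mul Th, sub_eq_zero.1 this.symm]
  have pos : ∀ x : L X, Th (incl x) ≠ 0 → 0 < (Th (incl x)).natDegree := by
    intro x hx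
    by_contra h0
    have h0 : (Th (incl x)).natDegree = 0 := by omega
    apply leadingCoeff_ne_zero.2 hx
    rw [leadingCoeff, h0, (hJ x).2.1]
  have hprim : ∀ x : L X, Prim (Th (incl x)).leadingCoeff := by
    intro x
    obtain ⟨x', hx'⟩ := (hJ x).2.2 (Th (incl x)).natDegree
    rw [leadingCoeff, hx']
    exact prim_incl x'
  have hhom : ∀ x : L X, Hom (Th (incl x)).natDegree (Th (incl x)).leadingCoeff :=
    fun x => Th_coeff _ _
  have hab : (Th (incl x)).leadingCoeff * (Th (incl y)).leadingCoeff =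
      (Th (incl y)).leadingCoeff * (Th (incl x)).leadingCoeff := by
    rw [← coeff_mul_degree_add_degree, ← coeff_mul_degree_add_degree, hcomm, add_comm]
  have ha0 := leadingCoeff_ne_zero.2 hP
  have hb0 := leadingCoeff_ne_zero.2 hQ
  rcases le_total (Th (incl x)).natDegree (Th (incl y)).natDegree with hle | hle
  · exact hom_case (pos x hP) hle (hhom x) (hhom y) (hprim x) (hprim y) ha0 hb0 hab
  · obtain ⟨h1, -⟩ := hom_case (pos y hQ) hle (hhom y) (hhom x) (hprim y) (hprim x) hb0 ha0 hab.symm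
    exact hom_case (pos x hP) h1.ge (hhom x) (hhom y) (hprim x) (hprim y) ha0 hb0 hab

lemma dependent (x y : L X) (hx : x ≠ 0) (h : ⁅x, y⁆ = 0) : ∃ c : ℂ, y = c • x := by
  by_cases hy : y = 0
  · exact ⟨0, by simp [hy]⟩
  obtain ⟨h1, c, hc⟩ := key x y hx hy h
  refine ⟨c, ?_⟩
  by_contra hne
  have hz : y - c • x ≠ 0 := sub_ne_zero.2 hne
  obtain ⟨h2, -⟩ := key x (y - c • x) hx hz (by simp [h])
  apply leadingCoeff_ne_zero.2 (Th_incl_ne hz)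
  rw [leadingCoeff, ← h2, map_sub, map_sub, map_smul, map_smul, coeff_sub, coeff_smul]
  conv_lhs => 
    enter [1]
    rw [h1]
  rw [coeff_natDegree, coeff_natDegree, hc, sub_self]

end
end FLA

/-- In a free Lie algebra over `ℂ`, any two commuting elements are linearly
dependent. -/
theorem freeLieAlgebra_commute_linearDependent (X : Type)
    (x y : FreeLieAlgebra ℂ X) (h : ⁅x, y⁆ = 0) :
    ¬ LinearIndependent ℂ ![x, y] := by
  classical
  intro hli
  have hx : x ≠ 0 := hli.ne_zero 0
  obtain ⟨c, hc⟩ := FLA.dependent x y hx h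
  rw [LinearIndependent.pair_iff] at hli
  have := (hli c (-1) (by rw [hc]; simp)).2
  simp at this
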